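/- (Distributed velocity observer.) Suppose Assumptions 1, 2 and 4 hold. Let v̂_i : [0,∞) → ℝ^N for i ∈ F be differentiable and satisfy the distributed observer v̂̇_i = −L_{p_i}( v̂_i − (1/κ_i)Σ_{j=1}^n a_{ij}·v̂_j(d_{ij}(t)) ) with L_{p_i} > 0, where v̂_j ≡ v_j for each leader j ∈ L. Then the stacked derivative v̂̇_F and the error v̂_F + (𝓛₁⁻¹𝓛₂ ⊗ I_N)v_L are uniformly bounded on [0,∞), v̂̇_F(t) → 0, v̂_F(t) + (𝓛₁⁻¹𝓛₂ ⊗ I_N)v_L(t) → 0, and in particular v̂_i(t) → v_d as t → ∞ for every i ∈ F, for arbitrary initial conditions and arbitrary T* > 0. -/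

import Mathlib

open Filter Matrix

noncomputable section

/-- In-degree of follower `i`: `κ_i = ∑_j a_{ij}`. Agents are `Fin m ⊕ Fin l`,
followers `Sum.inl`, leaders `Sum.inr`. -/
def kappa {m l : ℕ} (a : Fin m ⊕ Fin l → Fin m ⊕ Fin l → ℝ) (i : Fin m) : ℝ :=
  ∑ k, a (Sum.inl i) k

/-- The follower-follower block `𝓛₁ = D₁ − A₁` of the Laplacian. -/
def lapOne {m l : ℕ} (a : Fin m ⊕ Fin l → Fin m ⊕ Fin l → ℝ) :
    Matrix (Fin m) (Fin m) ℝ :=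
  Matrix.diagonal (kappa a) - Matrix.of (fun i j => a (Sum.inl i) (Sum.inl j))

/-- The follower-leader block `𝓛₂ = −A₂` of the Laplacian. -/
def lapTwo {m l : ℕ} (a : Fin m ⊕ Fin l → Fin m ⊕ Fin l → ℝ) :
    Matrix (Fin m) (Fin l) ℝ :=
  Matrix.of (fun i j => -(a (Sum.inl i) (Sum.inr j)))

/-- Assumption 1: every follower is reachable from some leader by a directed path. -/
def Assumption1 {m l : ℕ} (a : Fin m ⊕ Fin l → Fin m ⊕ Fin l → ℝ) : Prop :=
  ∀ i : Fin m, ∃ j : Fin l,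
    Relation.TransGen (fun x y => 0 < a y x) (Sum.inr j) (Sum.inl i)

/-- The containment error: `i`-th block of `x_F + (𝓛₁⁻¹𝓛₂ ⊗ I_N) x_L`. -/
def centErr {m l N : ℕ} (a : Fin m ⊕ Fin l → Fin m ⊕ Fin l → ℝ)
    (x : Fin m ⊕ Fin l → ℝ → EuclideanSpace ℝ (Fin N)) (i : Fin m) (t : ℝ) :
    EuclideanSpace ℝ (Fin N) :=
  x (Sum.inl i) t + ∑ j, ((lapOne a)⁻¹ * lapTwo a) i j • x (Sum.inr j) t

section Weights

variable {m l : ℕ} {a : Fin m ⊕ Fin l → Fin m ⊕ Fin l → ℝ}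

theorem kappa_pos (hann : ∀ k k', 0 ≤ a k k') (hA1 : Assumption1 a) (i : Fin m) :
    0 < kappa a i := by
  obtain ⟨j, hj⟩ := hA1 i
  obtain ⟨k, -, hk⟩ := Relation.TransGen.tail'_iff.1 hj
  exact Finset.sum_pos' (fun k _ => hann _ k) ⟨k, Finset.mem_univ k, hk⟩

/-- Maximum principle: a function which is subharmonic at the followers and vanishes at the
leaders is nonpositive. -/
theorem nonpos_of_subharmonic (hann : ∀ k k', 0 ≤ a k k') (hA1 : Assumption1 a)
    {c : Fin m ⊕ Fin l → ℝ} (hc : ∀ j, c (Sum.inr j) = 0)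
    (hsub : ∀ i, kappa a i * c (Sum.inl i) ≤ ∑ k, a (Sum.inl i) k * c k) (i : Fin m) :
    c (Sum.inl i) ≤ 0 := by
  have : Nonempty (Fin m) := ⟨i⟩
  obtain ⟨i₀, hi₀⟩ := Finite.exists_max fun i => c (Sum.inl i)
  refine (hi₀ i).trans ?_
  by_contra! hpos
  have hle : ∀ k, c k ≤ c (Sum.inl i₀) := by
    rintro (k | k)
    · exact hi₀ k
    · exact (hc k).trans_le hpos.le
  have hback : ∀ x y, 0 < a y x → c y = c (Sum.inl i₀) → c x = c (Sum.inl i₀) := by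
    rintro x (y | y) hxy hy
    · have h0 : ∑ k, a (Sum.inl y) k * (c (Sum.inl i₀) - c k) ≤ 0 := by
        have h := hsub y
        rw [hy, kappa, Finset.sum_mul] at h
        simp only [mul_sub, Finset.sum_sub_distrib]
        linarith
      have hterm := Finset.single_le_sum
        (f := fun k => a (Sum.inl y) k * (c (Sum.inl i₀) - c k))
        (fun k _ => mul_nonneg (hann _ k) (sub_nonneg.2 (hle k))) (Finset.mem_univ x)
      have : c (Sum.inl i₀) - c x ≤ 0 :=
        nonpos_of_mul_nonpos_right (hterm.trans h0) hxy
      exact le_antisymm (hle x) (by linarith)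
    · rw [hc] at hy
      exact absurd hy hpos.ne
  obtain ⟨j, hj⟩ := hA1 i₀
  have hreach : c (Sum.inr j) = c (Sum.inl i₀) :=
    Relation.TransGen.head_induction_on (motive := fun x _ => c x = c (Sum.inl i₀)) hj
      (fun h => hback _ _ h rfl) (fun h _ ih => hback _ _ h ih)
  rw [hc] at hreach
  exact hpos.ne hreach

theorem isUnit_lapOne (hann : ∀ k k', 0 ≤ a k k') (hA1 : Assumption1 a) :
    IsUnit (lapOne a) := by
  rw [← Matrix.mulVec_injective_iff_isUnit]
  refine (injective_iff_map_eq_zero (Matrix.mulVecLin (lapOne a))).2 fun x hx => ?_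
  have hx' : ∀ i, kappa a i * x i = ∑ k, a (Sum.inl i) (Sum.inl k) * x k := by
    intro i
    have h := congrFun hx i
    simp only [lapOne, Matrix.mulVecLin_apply, Matrix.sub_mulVec, Pi.sub_apply,
      Matrix.mulVec_diagonal, Pi.zero_apply, sub_eq_zero] at h
    exact h
  funext i
  refine abs_nonpos_iff.1 (nonpos_of_subharmonic hann hA1
    (c := Sum.elim (fun i => |x i|) fun _ => 0) (fun _ => rfl) (fun i => ?_) i)
  simp only [Sum.elim_inl, Fintype.sum_sum_type, Sum.elim_inr, mul_zero, Finset.sum_const_zero,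
    add_zero]
  rw [← abs_of_pos (kappa_pos hann hA1 i), ← abs_mul, hx']
  refine (Finset.abs_sum_le_sum_abs _ _).trans_eq (Finset.sum_congr rfl fun k _ => ?_)
  rw [abs_mul, abs_of_nonneg (hann _ _)]

theorem sum_inv_lapOne_mul_lapTwo (hann : ∀ k k', 0 ≤ a k k') (hA1 : Assumption1 a)
    (i : Fin m) : ∑ j, ((lapOne a)⁻¹ * lapTwo a) i j = -1 := by
  have hrow : lapTwo a *ᵥ 1 = -(lapOne a *ᵥ 1) := by
    funext i
    rw [Pi.neg_apply, lapOne, Matrix.sub_mulVec, Pi.sub_apply, Matrix.mulVec_diagonal]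
    simp [lapTwo, Matrix.mulVec, dotProduct, kappa]
  have h : ((lapOne a)⁻¹ * lapTwo a) *ᵥ 1 = -1 := by
    rw [← Matrix.mulVec_mulVec, hrow, Matrix.mulVec_neg, Matrix.mulVec_mulVec,
      Matrix.nonsing_inv_mul _ ((Matrix.isUnit_iff_isUnit_det _).1 (isUnit_lapOne hann hA1)),
      Matrix.one_mulVec]
  simpa [Matrix.mulVec, dotProduct] using congrFun h i

theorem norm_average_le {E : Type*} [NormedAddCommGroup E] [NormedSpace ℝ E]
    (hann : ∀ k k', 0 ≤ a k k') (hA1 : Assumption1 a) (i : Fin m)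
    {y : Fin m ⊕ Fin l → E} {c : Fin m ⊕ Fin l → ℝ}
    (h : ∀ k, 0 < a (Sum.inl i) k → ‖y k‖ ≤ c k) :
    ‖(kappa a i)⁻¹ • ∑ k, a (Sum.inl i) k • y k‖ ≤
      (kappa a i)⁻¹ * ∑ k, a (Sum.inl i) k * c k := by
  have hκ := inv_pos.2 (kappa_pos hann hA1 i)
  rw [norm_smul, Real.norm_of_nonneg hκ.le]
  refine mul_le_mul_of_nonneg_left (norm_sum_le_of_le _ fun k _ => ?_) hκ.le
  rw [norm_smul, Real.norm_of_nonneg (hann _ _)]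
  rcases (hann (Sum.inl i) k).eq_or_lt with h0 | h0
  · simp [← h0]
  · exact mul_le_mul_of_nonneg_left (h k h0) h0.le

theorem average_const {E : Type*} [NormedAddCommGroup E] [NormedSpace ℝ E]
    (hann : ∀ k k', 0 ≤ a k k') (hA1 : Assumption1 a) (i : Fin m) (w : E) :
    (kappa a i)⁻¹ • ∑ k, a (Sum.inl i) k • w = w := by
  rw [← Finset.sum_smul, smul_smul]
  change ((kappa a i)⁻¹ * kappa a i) • w = w
  rw [inv_mul_cancel₀ (kappa_pos hann hA1 i).ne', one_smul]

end Weights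

section Relaxation

variable {E : Type*} [NormedAddCommGroup E] [NormedSpace ℝ E]

/-- A first-order lag with gain `L` driven by an input bounded by `B`. -/
theorem norm_le_of_relaxation {L B t₀ T : ℝ} (hL : 0 < L) {y u : ℝ → E}
    (hy : ∀ t ∈ Set.Icc t₀ T, HasDerivAt y (-L • (y t - u t)) t)
    (hu : ∀ t ∈ Set.Icc t₀ T, ‖u t‖ ≤ B) {t : ℝ} (ht : t ∈ Set.Icc t₀ T) :
    ‖y t‖ ≤ B + Real.exp (-(L * (t - t₀))) * (‖y t₀‖ - B) := by
  have hexp : ∀ s, HasDerivAt (fun s => Real.exp (L * (s - t₀)))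
      (Real.exp (L * (s - t₀)) * L) s := fun s => by
    simpa using (((hasDerivAt_id s).sub_const t₀).const_mul L).exp
  have hz : ∀ s ∈ Set.Icc t₀ T, HasDerivAt (fun s => Real.exp (L * (s - t₀)) • y s)
      ((Real.exp (L * (s - t₀)) * L) • u s) s := fun s hs =>
    ((hexp s).smul (hy s hs)).congr_deriv (by module)
  have key := image_norm_le_of_norm_deriv_right_le_deriv_boundary
    (f := fun s => Real.exp (L * (s - t₀)) • y s)
    (B := fun s => ‖y t₀‖ + B * (Real.exp (L * (s - t₀)) - 1))
    (fun s hs => (hz s hs).continuousAt.continuousWithinAt)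
    (fun s hs => (hz s (Set.Ico_subset_Icc_self hs)).hasDerivWithinAt)
    (by simp)
    (fun s => (((hexp s).sub_const 1).const_mul B).const_add ‖y t₀‖)
    (fun s hs => by
      rw [norm_smul, Real.norm_of_nonneg (by positivity), mul_comm B]
      exact mul_le_mul_of_nonneg_left (hu s (Set.Ico_subset_Icc_self hs)) (by positivity)) ht
  rw [norm_smul, Real.norm_of_nonneg (Real.exp_pos _).le] at key
  have hinv : Real.exp (-(L * (t - t₀))) * Real.exp (L * (t - t₀)) = 1 := by
    rw [← Real.exp_add]; simp
  have := mul_le_mul_of_nonneg_left key (Real.exp_pos (-(L * (t - t₀)))).le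
  linear_combination this + (B - ‖y t‖) * hinv

theorem eventually_norm_le_of_relaxation {L B B' : ℝ} (hL : 0 < L) (hB : B < B') {y u : ℝ → E}
    (hy : ∀ᶠ t in atTop, HasDerivAt y (-L • (y t - u t)) t)
    (hu : ∀ᶠ t in atTop, ‖u t‖ ≤ B) : ∀ᶠ t in atTop, ‖y t‖ ≤ B' := by
  obtain ⟨t₀, h⟩ := eventually_atTop.1 (hy.and hu)
  have hlim : Tendsto (fun t => B + Real.exp (-(L * (t - t₀))) * (‖y t₀‖ - B)) atTop
      (nhds (B + 0 * (‖y t₀‖ - B))) := by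
    refine Tendsto.const_add _ (Tendsto.mul_const _ (Real.tendsto_exp_neg_atTop_nhds_zero.comp ?_))
    exact (tendsto_atTop_add_const_right _ (-t₀) tendsto_id).const_mul_atTop hL
  rw [zero_mul, add_zero] at hlim
  filter_upwards [hlim.eventually_lt_const hB, eventually_ge_atTop t₀] with t ht ht₀
  exact (norm_le_of_relaxation hL (fun s hs => (h s hs.1).1) (fun s hs => (h s hs.1).2)
    (Set.right_mem_Icc.2 ht₀)).trans ht.le

end Relaxation

section Observer

variable {m l : ℕ} {a : Fin m ⊕ Fin l → Fin m ⊕ Fin l → ℝ}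
  {E : Type*} [NormedAddCommGroup E] [NormedSpace ℝ E]
  {d : Fin m → Fin m ⊕ Fin l → ℝ → ℝ} {Lp : Fin m → ℝ} {x : Fin m ⊕ Fin l → ℝ → E}

theorem observer_bounded (hann : ∀ k k', 0 ≤ a k k') (hA1 : Assumption1 a)
    (hd0 : ∀ i j, 0 < a (Sum.inl i) j → ∀ t, 0 ≤ t → 0 ≤ d i j t ∧ d i j t ≤ t)
    (hLp : ∀ i, 0 < Lp i)
    (hobs : ∀ (i : Fin m) (t : ℝ), 0 ≤ t → HasDerivAt (x (Sum.inl i))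
      (-(Lp i) • (x (Sum.inl i) t -
        (kappa a i)⁻¹ • ∑ j, a (Sum.inl i) j • x j (d i j t))) t)
    (hlead : ∀ j : Fin l, ∃ C, ∀ t, 0 ≤ t → ‖x (Sum.inr j) t‖ ≤ C) :
    ∃ C, ∀ k t, 0 ≤ t → ‖x k t‖ ≤ C := by
  choose Cl hCl using hlead
  obtain ⟨C, hC⟩ := Finite.exists_le (Sum.elim (fun i => ‖x (Sum.inl i) 0‖) Cl)
  have hCr : ∀ j t, 0 ≤ t → ‖x (Sum.inr j) t‖ ≤ C := fun j t ht =>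
    (hCl j t ht).trans (hC (Sum.inr j))
  refine ⟨C, ?_⟩
  rintro (i | j) T hT
  swap
  · exact hCr j T hT
  have : Nonempty (Fin m) := ⟨i⟩
  have hmax : ∀ i, ∃ s ∈ Set.Icc 0 T, ∀ t ∈ Set.Icc 0 T,
      ‖x (Sum.inl i) t‖ ≤ ‖x (Sum.inl i) s‖ := fun i =>
    isCompact_Icc.exists_isMaxOn (Set.nonempty_Icc.2 hT)
      fun t ht => (hobs i t ht.1).continuousAt.norm.continuousWithinAt
  choose s hs hsmax using hmax
  obtain ⟨i₀, hi₀⟩ := Finite.exists_max fun i => ‖x (Sum.inl i) (s i)‖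
  refine (hsmax i T (Set.right_mem_Icc.2 hT)).trans ((hi₀ i).trans ?_)
  by_contra! hlt
  set M := ‖x (Sum.inl i₀) (s i₀)‖ with hM
  have hu : ∀ t ∈ Set.Icc 0 T,
      ‖(kappa a i₀)⁻¹ • ∑ j, a (Sum.inl i₀) j • x j (d i₀ j t)‖ ≤ M := by
    intro t ht
    refine (norm_average_le hann hA1 i₀ (c := fun _ => M) ?_).trans_eq
      (average_const hann hA1 i₀ M)
    rintro (k | k) hk
    · have hd := hd0 i₀ _ hk t ht.1
      exact (hsmax k _ ⟨hd.1, hd.2.trans ht.2⟩).trans (hi₀ k)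
    · exact (hCr k _ (hd0 i₀ _ hk t ht.1).1).trans hlt.le
  have key := norm_le_of_relaxation (hLp i₀) (fun t ht => hobs i₀ t ht.1) hu (hs i₀)
  rw [← hM] at key
  have hneg : ‖x (Sum.inl i₀) 0‖ - M < 0 := by
    have := hC (Sum.inl i₀)
    simp only [Sum.elim_inl] at this
    linarith
  have := mul_neg_of_pos_of_neg (Real.exp_pos (-(Lp i₀ * (s i₀ - 0)))) hneg
  linarith

theorem observer_tendsto_zero (hann : ∀ k k', 0 ≤ a k k') (hA1 : Assumption1 a)
    (hd0 : ∀ i j, 0 < a (Sum.inl i) j → ∀ t, 0 ≤ t → 0 ≤ d i j t ∧ d i j t ≤ t)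
    (hdlim : ∀ i j, 0 < a (Sum.inl i) j → Tendsto (d i j) atTop atTop)
    (hLp : ∀ i, 0 < Lp i)
    (hobs : ∀ (i : Fin m) (t : ℝ), 0 ≤ t → HasDerivAt (x (Sum.inl i))
      (-(Lp i) • (x (Sum.inl i) t -
        (kappa a i)⁻¹ • ∑ j, a (Sum.inl i) j • x j (d i j t))) t)
    (hlead : ∀ j : Fin l, ∃ C, ∀ t, 0 ≤ t → ‖x (Sum.inr j) t‖ ≤ C)
    (hlim : ∀ j : Fin l, Tendsto (x (Sum.inr j)) atTop (nhds 0)) (i : Fin m) :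
    Tendsto (x (Sum.inl i)) atTop (nhds 0) := by
  obtain ⟨C, hC⟩ := observer_bounded hann hA1 hd0 hLp hobs hlead
  have hbdd : ∀ k, IsBoundedUnder (· ≤ ·) atTop fun t => ‖x k t‖ := fun k =>
    isBoundedUnder_of_eventually_le ((eventually_ge_atTop 0).mono (hC k))
  have hcobdd : ∀ k, IsCoboundedUnder (· ≤ ·) atTop fun t => ‖x k t‖ := fun k =>
    (isBoundedUnder_of_eventually_ge (Eventually.of_forall
      fun t => norm_nonneg (x k t))).isCoboundedUnder_le
  set c : Fin m ⊕ Fin l → ℝ := fun k => limsup (fun t => ‖x k t‖) atTop with hc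
  have hcr : ∀ j, c (Sum.inr j) = 0 := fun j =>
    (tendsto_zero_iff_norm_tendsto_zero.1 (hlim j)).limsup_eq
  have hev : ∀ k b, c k < b → ∀ᶠ t in atTop, ‖x k t‖ < b := fun k b hb =>
    eventually_lt_of_limsup_lt hb (hbdd k)
  have hsub : ∀ i, kappa a i * c (Sum.inl i) ≤ ∑ k, a (Sum.inl i) k * c k := by
    intro i
    have hκ := kappa_pos hann hA1 i
    rw [← le_inv_mul_iff₀ hκ]
    refine le_of_forall_pos_le_add fun ε hε => limsup_le_of_le (hcobdd _) ?_
    have hu : ∀ᶠ t in atTop, ‖(kappa a i)⁻¹ • ∑ j, a (Sum.inl i) j • x j (d i j t)‖ ≤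
        (kappa a i)⁻¹ * ∑ k, a (Sum.inl i) k * c k + ε / 2 := by
      have h : ∀ᶠ t in atTop, ∀ k, 0 < a (Sum.inl i) k → ‖x k (d i k t)‖ ≤ c k + ε / 2 := by
        refine eventually_all.2 fun k => ?_
        by_cases hk : 0 < a (Sum.inl i) k
        · filter_upwards [(hdlim i k hk).eventually (hev k (c k + ε / 2) (by linarith))]
            with t ht _ using ht.le
        · exact Eventually.of_forall fun t h => absurd h hk
      filter_upwards [h] with t ht
      refine (norm_average_le hann hA1 i ht).trans_eq ?_
      have := average_const hann hA1 i (ε / 2)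
      simp only [smul_eq_mul] at this
      simp only [mul_add, Finset.sum_add_distrib, this]
    exact eventually_norm_le_of_relaxation (hLp i) (by linarith)
      ((eventually_ge_atTop 0).mono (hobs i)) hu
  have hle := nonpos_of_subharmonic hann hA1 hcr hsub i
  refine tendsto_zero_iff_norm_tendsto_zero.2 (tendsto_order.2 ⟨fun b hb => ?_, fun b hb => ?_⟩)
  · exact Eventually.of_forall fun t => hb.trans_le (norm_nonneg _)
  · exact hev _ b (hle.trans_lt hb)

end Observer

/-- The distributed velocity observer: under Assumptions 1, 2 and 4, the
observer derivatives and the observer error `v̂_F + (𝓛₁⁻¹𝓛₂ ⊗ I_N) v_L` are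
uniformly bounded and converge to zero, and each follower's observer state
converges to the leaders' steady-state velocity `v_d`, for arbitrary initial
conditions and arbitrary `T* > 0`. -/
theorem stmt9 {m l N : ℕ}
    (a : Fin m ⊕ Fin l → Fin m ⊕ Fin l → ℝ)
    (ha0 : ∀ k, a k k = 0)
    (hann : ∀ k k', 0 ≤ a k k')
    (haL : ∀ (j : Fin l) (k : Fin m ⊕ Fin l), a (Sum.inr j) k = 0)
    (hA1 : Assumption1 a)
    -- Assumption 2: communication blackouts
    (d : Fin m → Fin m ⊕ Fin l → ℝ → ℝ) (Tstar : ℝ) (hT : 0 < Tstar)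
    (hd0 : ∀ i j, 0 < a (Sum.inl i) j → ∀ t, 0 ≤ t → 0 ≤ d i j t ∧ d i j t ≤ t)
    (hdT : ∀ i j, 0 < a (Sum.inl i) j → ∀ t, Tstar ≤ t → t - d i j t ≤ Tstar)
    -- Assumption 4 on the leaders' velocities
    (v : Fin l → ℝ → EuclideanSpace ℝ (Fin N))
    (vdotL : Fin l → ℝ → EuclideanSpace ℝ (Fin N))
    (hvdiff : ∀ (j : Fin l) (t : ℝ), 0 ≤ t → HasDerivAt (v j) (vdotL j t) t)
    (vd : EuclideanSpace ℝ (Fin N))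
    (hvLb : ∀ j : Fin l, ∃ C, ∀ t, 0 ≤ t → ‖v j t‖ ≤ C)
    (hvdot0 : ∀ j : Fin l, Tendsto (vdotL j) atTop (nhds 0))
    (hvL : ∀ j : Fin l, Tendsto (v j) atTop (nhds vd))
    -- observer gains
    (Lp : Fin m → ℝ) (hLp : ∀ i, 0 < Lp i)
    -- the distributed observer, with `v̂_j ≡ v_j` for leaders
    (vhat : Fin m ⊕ Fin l → ℝ → EuclideanSpace ℝ (Fin N))
    (hvhatL : ∀ j : Fin l, vhat (Sum.inr j) = v j)
    (hobs : ∀ (i : Fin m) (t : ℝ), 0 ≤ t →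
      HasDerivAt (vhat (Sum.inl i))
        (-(Lp i) • (vhat (Sum.inl i) t -
            (kappa a i)⁻¹ • ∑ j, a (Sum.inl i) j • vhat j (d i j t))) t) :
    (∃ C, ∀ t, 0 ≤ t → ∀ i : Fin m, ‖deriv (vhat (Sum.inl i)) t‖ ≤ C) ∧
    (∃ C, ∀ t, 0 ≤ t → ∀ i : Fin m, ‖centErr a vhat i t‖ ≤ C) ∧
    (∀ i : Fin m, Tendsto (deriv (vhat (Sum.inl i))) atTop (nhds 0)) ∧
    (∀ i : Fin m, Tendsto (centErr a vhat i) atTop (nhds 0)) ∧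
    (∀ i : Fin m, Tendsto (vhat (Sum.inl i)) atTop (nhds vd)) := by
  have hdlim : ∀ i j, 0 < a (Sum.inl i) j → Tendsto (d i j) atTop atTop := fun i j hij =>
    tendsto_atTop_mono' atTop
      ((eventually_ge_atTop Tstar).mono fun t ht => by
        have := hdT i j hij t ht
        change t + -Tstar ≤ d i j t
        linarith)
      (tendsto_atTop_add_const_right _ (-Tstar) tendsto_id)
  have hlead : ∀ j : Fin l, ∃ C, ∀ t, 0 ≤ t → ‖vhat (Sum.inr j) t‖ ≤ C := by
    simpa only [hvhatL] using hvLb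
  obtain ⟨C, hC⟩ := observer_bounded hann hA1 hd0 hLp hobs hlead
  have hshift := observer_tendsto_zero (x := fun k t => vhat k t - vd) hann hA1 hd0 hdlim hLp
    (fun i t ht => by
      convert (hobs i t ht).sub_const vd using 2
      simp only [smul_sub, Finset.sum_sub_distrib]
      rw [average_const hann hA1 i vd]
      abel)
    (fun j => ⟨C + ‖vd‖, fun t ht => (norm_sub_le _ _).trans (by grw [hC _ t ht])⟩)
    (fun j => by simpa [hvhatL] using (hvL j).sub_const vd)
  have hlim : ∀ k, Tendsto (vhat k) atTop (nhds vd) := by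
    rintro (i | j)
    · simpa using (hshift i).add_const vd
    · rw [hvhatL]
      exact hvL j
  have hterm : ∀ i k, Tendsto (fun t => a (Sum.inl i) k • vhat k (d i k t)) atTop
      (nhds (a (Sum.inl i) k • vd)) := by
    intro i k
    rcases (hann (Sum.inl i) k).eq_or_lt with h0 | h0
    · simp [← h0]
    · exact ((hlim k).comp (hdlim i k h0)).const_smul _
  refine ⟨?_, ?_, fun i => ?_, fun i => ?_, fun i => hlim _⟩
  · obtain ⟨G, hG⟩ := Finite.exists_le Lp
    refine ⟨G * (C + C), fun t ht i => ?_⟩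
    have hu : ‖(kappa a i)⁻¹ • ∑ j, a (Sum.inl i) j • vhat j (d i j t)‖ ≤ C :=
      (norm_average_le hann hA1 i (c := fun _ => C)
        fun k hk => hC k _ (hd0 i k hk t ht).1).trans_eq (average_const hann hA1 i C)
    rw [(hobs i t ht).deriv, norm_smul, norm_neg, Real.norm_of_nonneg (hLp i).le]
    exact mul_le_mul (hG i) ((norm_sub_le _ _).trans (add_le_add (hC _ t ht) hu))
      (norm_nonneg _) ((hLp i).le.trans (hG i))
  · obtain ⟨S, hS⟩ := Finite.exists_le
      fun i => ∑ j, ‖((lapOne a)⁻¹ * lapTwo a) i j‖ * C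
    refine ⟨C + S, fun t ht i => norm_add_le_of_le (hC _ t ht) (le_trans ?_ (hS i))⟩
    refine norm_sum_le_of_le _ fun j _ => ?_
    rw [norm_smul]
    exact mul_le_mul_of_nonneg_left (hC _ t ht) (norm_nonneg _)
  · have h := (((hlim (Sum.inl i)).sub ((tendsto_finsetSum Finset.univ
      fun k _ => hterm i k).const_smul (kappa a i)⁻¹)).const_smul (-(Lp i)))
    rw [average_const hann hA1 i vd, sub_self, smul_zero] at h
    refine h.congr' ?_
    filter_upwards [eventually_ge_atTop 0] with t ht using (hobs i t ht).deriv.symm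
  · have h := (hlim (Sum.inl i)).add (tendsto_finsetSum Finset.univ fun j _ =>
      (hlim (Sum.inr j)).const_smul (((lapOne a)⁻¹ * lapTwo a) i j))
    rw [← Finset.sum_smul, sum_inv_lapOne_mul_lapTwo hann hA1, neg_one_smul, add_neg_cancel] at h
    exact h
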